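/- arXiv:1610.05616 — 3 statements merged into one kernel-verified Lean document; each statement's English description precedes it below -/
import Mathlib

section
/- For integers k and n with 3 ≤ k ≤ n, the k-rainbow index of the cycle C_n satisfies: rx_k(C_n) = n − 2 if k = 3 and n ≥ 4, and rx_k(C_n) = n − 1 if k = n = 3 or 4 ≤ k ≤ n. -/
open SimpleGraph

namespace RainbowIndex

variable {V : Type*} {W : Type*}

/-- `T` is an `S`-tree in `G`: a subgraph of `G` containing `S` that is a tree. -/
def IsSTree (G : SimpleGraph V) (S : Set V) (T : G.Subgraph) : Prop :=
  S ⊆ T.verts ∧ T.coe.IsTree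

/-- The Steiner distance of a vertex set `S`: the minimum number of edges of a tree
in `G` containing `S`. -/
noncomputable def steinerDist (G : SimpleGraph V) (S : Set V) : ℕ :=
  sInf {m | ∃ T : G.Subgraph, IsSTree G S T ∧ T.edgeSet.ncard = m}

/-- The `k`-Steiner diameter of `G`: the maximum Steiner distance over all `k`-subsets. -/
noncomputable def sdiam (G : SimpleGraph V) (k : ℕ) : ℕ :=
  sSup {m | ∃ S : Finset V, S.card = k ∧ steinerDist G (S : Set V) = m}

/-- An edge-coloring `c` is a `k`-rainbow coloring of `G` if every `k`-subset `S` of the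
vertices is connected by a tree whose edges receive pairwise distinct colors. -/
def IsRainbowColoring {α : Type*} (G : SimpleGraph V) (k : ℕ) (c : Sym2 V → α) : Prop :=
  ∀ S : Finset V, S.card = k →
    ∃ T : G.Subgraph, IsSTree G (S : Set V) T ∧ Set.InjOn c T.edgeSet

/-- The `k`-rainbow index of `G`: the minimum number of colors in a `k`-rainbow coloring. -/
noncomputable def rxIndex (G : SimpleGraph V) (k : ℕ) : ℕ :=
  sInf {n | ∃ c : Sym2 V → Fin n, IsRainbowColoring G k c}

/-- `G` is `X`-free: `G` contains no induced subgraph isomorphic to `X`. -/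
def Free (G : SimpleGraph V) (X : SimpleGraph W) : Prop :=
  IsEmpty (X ↪g G)

/-- The star `K_{1,r}` with `r` leaves. -/
def starGraph (r : ℕ) : SimpleGraph (Fin 1 ⊕ Fin r) :=
  completeBipartiteGraph (Fin 1) (Fin r)

/-- The graph `K_s^h` obtained from the complete graph `K_s` by attaching one pendant
edge to each of its `s` vertices. -/
def Khat (s : ℕ) : SimpleGraph (Fin s ⊕ Fin s) :=
  SimpleGraph.fromRel (fun a b =>
    match a, b with
    | Sum.inl i, Sum.inl j => i ≠ j
    | Sum.inl i, Sum.inr j => i = j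
    | _, _ => False)

/-- `α_i(G,c)`: the maximum size of an independent set of `G` contained in the ball of
radius `i` around `c`. -/
noncomputable def alphaBall (G : SimpleGraph V) (c : V) (i : ℕ) : ℕ :=
  sSup {m | ∃ M : Finset V, (∀ v ∈ M, G.dist c v ≤ i) ∧
    (M : Set V).Pairwise (fun u v => ¬ G.Adj u v) ∧ M.card = m}

/-- `α_i^0(G,c)`: the maximum size of an independent set of `G` contained in the sphere of
radius `i` around `c`. -/
noncomputable def alphaSphere (G : SimpleGraph V) (c : V) (i : ℕ) : ℕ :=
  sSup {m | ∃ M : Finset V, (∀ v ∈ M, G.dist c v = i) ∧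
    (M : Set V).Pairwise (fun u v => ¬ G.Adj u v) ∧ M.card = m}

/-- The eccentricity of a vertex `c`. -/
noncomputable def ecc (G : SimpleGraph V) (c : V) : ℕ :=
  sSup {d | ∃ v, G.dist c v = d}

/-- The Ramsey number `R(a,b)`: the smallest `n` such that every graph on `n` vertices
contains a clique of size `a` or an independent set of size `b`. -/
noncomputable def ramsey (a b : ℕ) : ℕ :=
  sInf {n | ∀ G : SimpleGraph (Fin n),
    (∃ s : Finset (Fin n), G.IsNClique a s) ∨ (∃ s : Finset (Fin n), Gᶜ.IsNClique b s)}

end RainbowIndex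

namespace RainbowIndex

open Finset in
/-- Among `n` objects receiving `m` colors, either some color is used at least three times
or at least `n - m` colors are used exactly twice. -/
theorem exists_three_or_card_two {α β : Type*} [Fintype α] [Fintype β] [DecidableEq β]
    (f : α → β) :
    (∃ b, 3 ≤ #{a | f a = b}) ∨
      Fintype.card α ≤ Fintype.card β + #{b : β | #{a | f a = b} = 2} := by
  by_contra! h
  obtain ⟨h3, hlt⟩ := h
  have hsum : Fintype.card α = ∑ b : β, #{a | f a = b} :=
    card_eq_sum_card_fiberwise (f := f) (fun _ _ => mem_univ _)
  have hle : ∑ b : β, #{a | f a = b} ≤ ∑ b : β, (1 + if #{a | f a = b} = 2 then 1 else 0) := by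
    refine sum_le_sum fun b _ => ?_
    have := h3 b
    split_ifs <;> omega
  rw [sum_add_distrib, ← card_filter] at hle
  simp only [sum_const, smul_eq_mul, mul_one, card_univ] at hle
  omega

open Finset in
/-- If every fiber over `D` has two elements, the preimage of `D` has `2 * #D` elements. -/
theorem card_preimage_of_fiber_two {α β : Type*} [Fintype α] [DecidableEq β]
    (f : α → β) (D : Finset β) (hD : ∀ b ∈ D, #{a | f a = b} = 2) :
    #{a | f a ∈ D} = 2 * #D := by
  rw [card_eq_sum_card_fiberwise (f := f) (t := D) (fun a ha => by simpa using ha),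
    sum_congr rfl (g := fun _ => 2), sum_const, smul_eq_mul, mul_comm]
  intro b hb
  rw [← hD b hb, filter_filter]
  congr 1
  ext a
  simp only [mem_filter, mem_univ, true_and, and_iff_right_iff_imp]
  rintro rfl
  exact hb

section Cycle

variable {n : ℕ} [NeZero n]

/-- The edge of the cycle joining `i` to its successor. -/
def cycEdge (i : Fin n) : Sym2 (Fin n) := s(i, i + 1)

theorem val_add_one_eq (hn : 2 ≤ n) (i : Fin n) :
    (i + 1).val = if i.val + 1 = n then 0 else i.val + 1 := by
  have h1 : (1 : Fin n).val = 1 := by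
    rw [Fin.val_one', Nat.mod_eq_of_lt hn]
  have := i.isLt
  rw [Fin.val_add_eq_ite, h1]
  split_ifs <;> omega

theorem cycleGraph_adj_iff (hn : 2 ≤ n) {u v : Fin n} :
    (cycleGraph n).Adj u v ↔ v = u + 1 ∨ u = v + 1 := by
  obtain ⟨m, rfl⟩ := Nat.exists_eq_add_of_le' hn
  rw [cycleGraph_adj, or_comm, sub_eq_iff_eq_add', sub_eq_iff_eq_add', add_comm u, add_comm v]

theorem cycEdge_injective (hn : 3 ≤ n) : Function.Injective (cycEdge (n := n)) := by
  intro i j h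
  have hi := val_add_one_eq (by omega) i
  have hj := val_add_one_eq (by omega) j
  rcases Sym2.eq_iff.1 h with ⟨h, -⟩ | ⟨h1, h2⟩
  · exact h
  · rw [← h1] at hj
    rw [h2] at hi
    ext
    split_ifs at hi hj <;> omega

/-- A connected subgraph of the cycle missing two edges lies on one side of the cut they form. -/
theorem mem_arc_of_not_mem_edgeSet (hn : 3 ≤ n) {T : (cycleGraph n).Subgraph}
    (hT : T.coe.Connected) {i j : Fin n}
    (hi : cycEdge i ∉ T.edgeSet) (hj : cycEdge j ∉ T.edgeSet) {u v : Fin n}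
    (hu : u ∈ T.verts) (hv : v ∈ T.verts) (hiu : i < u) (huj : u ≤ j) :
    i < v ∧ v ≤ j := by
  have step : ∀ x : Fin n, cycEdge x ∈ T.edgeSet → (i < x ∧ x ≤ j ↔ i < x + 1 ∧ x + 1 ≤ j) := by
    intro x hx
    have hxi : x.val ≠ i.val := fun h => hi (Fin.ext h ▸ hx)
    have hxj : x.val ≠ j.val := fun h => hj (Fin.ext h ▸ hx)
    have hx1 := val_add_one_eq (by omega) x
    have := j.isLt
    simp only [Fin.lt_def, Fin.le_def]
    split_ifs at hx1 <;> omega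
  have key : ∀ x y : T.verts, T.coe.Adj x y →
      (i < x.1 ∧ x.1 ≤ j ↔ i < y.1 ∧ y.1 ≤ j) := by
    intro x y hxy
    have hxy : T.Adj x y := hxy
    rcases (cycleGraph_adj_iff (by omega)).1 hxy.adj_sub with h | h
    · rw [h]
      exact step _ (by rw [cycEdge, ← h]; exact hxy)
    · rw [h]
      exact (step _ (by rw [cycEdge, ← h]; exact hxy.symm)).symm
  obtain ⟨w⟩ := hT.preconnected ⟨u, hu⟩ ⟨v, hv⟩
  have hw : ∀ (a b : T.verts), T.coe.Walk a b → (i < a.1 ∧ a.1 ≤ j ↔ i < b.1 ∧ b.1 ≤ j) := by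
    intro a b p
    induction p with
    | nil => rfl
    | cons h _ ih => exact (key _ _ h).trans ih
  exact (hw _ _ w).1 ⟨hiu, huj⟩

open Finset in
/-- A rainbow subgraph misses at least `#R - #c(R)` of the edges in `R`. -/
theorem card_image_add_card_missing {α : Type*} [DecidableEq α] (hn : 3 ≤ n)
    {T : (cycleGraph n).Subgraph} {c : Sym2 (Fin n) → α} (hc : Set.InjOn c T.edgeSet)
    (R : Finset (Fin n)) [DecidablePred fun i : Fin n => cycEdge i ∈ T.edgeSet] :
    #R ≤ #(R.image fun i => c (cycEdge i)) + #{i ∈ R | cycEdge i ∉ T.edgeSet} := by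
  rw [← card_filter_add_card_filter_not (s := R) (fun i => cycEdge i ∈ T.edgeSet)]
  refine Nat.add_le_add_right ?_ _
  rw [← card_image_of_injOn (s := {i ∈ R | cycEdge i ∈ T.edgeSet})
    (f := fun i => c (cycEdge i))]
  · exact card_le_card (image_subset_image (filter_subset _ _))
  · intro i hi j hj h
    simp only [coe_filter, Set.mem_ofPred_eq] at hi hj
    exact cycEdge_injective hn (hc hi.2 hj.2 h)

open Finset in
/-- A coloring repeating colors twice on a set of at most `k` edges is not `k`-rainbow. -/
theorem not_isRainbowColoring_of_card_image_add_two {α : Type*} [DecidableEq α] (hn : 3 ≤ n)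
    {k : ℕ} (hk : k ≤ n) {c : Sym2 (Fin n) → α} (R : Finset (Fin n)) (hRk : #R ≤ k)
    (hR : #(R.image fun i => c (cycEdge i)) + 2 ≤ #R) :
    ¬ IsRainbowColoring (cycleGraph n) k c := by
  classical
  intro h
  obtain ⟨S, hRS, hS⟩ := exists_superset_card_eq hRk (by simpa using hk)
  obtain ⟨T, ⟨hST, hT⟩, hc⟩ := h S hS
  have hM := card_image_add_card_missing hn hc R
  obtain ⟨i, hi, j, hj, hij⟩ :=
    one_lt_card.1 (show 1 < #{i ∈ R | cycEdge i ∉ T.edgeSet} by omega)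
  rw [mem_filter] at hi hj
  wlog hlt : i < j generalizing i j
  · exact this j hj i hi hij.symm (lt_of_le_of_ne (not_lt.1 hlt) hij.symm)
  exact lt_irrefl i (mem_arc_of_not_mem_edgeSet hn hT.1 hi.2 hj.2 (hST (hRS hj.1))
    (hST (hRS hi.1)) hlt le_rfl).1

open Finset in
/-- A coloring using at most three colors on some six edges is not `3`-rainbow. -/
theorem not_isRainbowColoring_three_of_six {α : Type*} [DecidableEq α] (hn : 3 ≤ n)
    {c : Sym2 (Fin n) → α} (R : Finset (Fin n)) (hR6 : #R = 6)
    (hR : #(R.image fun i => c (cycEdge i)) ≤ 3) :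
    ¬ IsRainbowColoring (cycleGraph n) 3 c := by
  classical
  intro h
  let p := R.orderEmbOfFin hR6
  obtain ⟨T, ⟨hST, hT⟩, hc⟩ := h (({1, 3, 5} : Finset (Fin 6)).map p.toEmbedding)
    (by rw [card_map]; rfl)
  have hmem : ∀ r ∈ ({1, 3, 5} : Finset (Fin 6)), p r ∈ T.verts := fun r hr =>
    hST (by simpa using hr)
  have hM := card_image_add_card_missing hn hc R
  let M : Finset (Fin 6) := {r | cycEdge (p r) ∉ T.edgeSet}
  have hMcard : #{i ∈ R | cycEdge i ∉ T.edgeSet} = #M := by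
    rw [← card_map p.toEmbedding]
    congr 1
    ext i
    have hi : i ∈ R ↔ ∃ r, p r = i := by
      rw [← Set.mem_range, range_orderEmbOfFin, mem_coe]
    simp only [mem_filter, hi, mem_map, M, mem_univ, true_and]
    constructor
    · rintro ⟨⟨r, rfl⟩, h⟩
      exact ⟨r, h, rfl⟩
    · rintro ⟨r, h, rfl⟩
      exact ⟨⟨r, rfl⟩, h⟩
  have sep : ∀ r ∈ M, ∀ s ∈ M, ∀ a ∈ ({1, 3, 5} : Finset (Fin 6)),
      ∀ b ∈ ({1, 3, 5} : Finset (Fin 6)), r < a → a ≤ s → r < b ∧ b ≤ s := by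
    intro r hr s hs a ha b hb hra has
    simp only [M, mem_filter, mem_univ, true_and] at hr hs
    simpa using mem_arc_of_not_mem_edgeSet hn hT.1 hr hs (hmem a ha) (hmem b hb)
      (p.lt_iff_lt.2 hra) (p.le_iff_le.2 has)
  have hM3 : 3 ≤ #M := by omega
  clear_value M
  clear hM hMcard
  revert M
  decide

theorem isTree_pathGraph (l : ℕ) : (pathGraph (l + 1)).IsTree := by
  rw [isTree_iff_connected_and_card]
  refine ⟨pathGraph_connected l, ?_⟩
  have hge := (pathGraph_connected l).card_vert_le_card_edgeSet_add_one
  let e : Fin l → (pathGraph (l + 1)).edgeSet := fun i =>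
    ⟨s(i.castSucc, i.succ), by simp [pathGraph_adj]⟩
  have he : Function.Surjective e := by
    rintro ⟨x, hx⟩
    induction x with | _ u v
    have h : u.val + 1 = v.val ∨ v.val + 1 = u.val := pathGraph_adj.1 hx
    rcases h with h | h
    · refine ⟨⟨u, by omega⟩, Subtype.ext (Sym2.eq_iff.2 (Or.inl ⟨Fin.ext rfl, Fin.ext h⟩))⟩
    · refine ⟨⟨v, by omega⟩, Subtype.ext (Sym2.eq_iff.2 (Or.inr ⟨Fin.ext rfl, Fin.ext h⟩))⟩
  have hle := Nat.card_le_card_of_surjective e he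
  simp only [Nat.card_eq_fintype_card, Fintype.card_fin] at hge hle ⊢
  omega

/-- The arc of the cycle with `l` edges starting at `a` is a tree. -/
theorem exists_arc_tree (hn : 2 ≤ n) (a : ℕ) {l : ℕ} (hl : l < n) :
    ∃ T : (cycleGraph n).Subgraph, T.coe.IsTree ∧
      (∀ j ≤ l, Fin.ofNat n (a + j) ∈ T.verts) ∧
      ∀ e ∈ T.edgeSet, ∃ j < l, e = cycEdge (Fin.ofNat n (a + j)) := by
  have hsucc : ∀ x : ℕ, Fin.ofNat n x + 1 = Fin.ofNat n (x + 1) := fun x => by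
    ext
    simp [Fin.val_add]
  let f : pathGraph (l + 1) →g cycleGraph n :=
    { toFun := fun j => Fin.ofNat n (a + j.val)
      map_rel' := by
        intro u v huv
        rw [cycleGraph_adj_iff hn, hsucc, hsucc, add_assoc, add_assoc]
        rcases pathGraph_adj.1 huv with h | h
        · exact Or.inl (by rw [h])
        · exact Or.inr (by rw [h]) }
  have hf : Function.Injective f := by
    intro u v huv
    have h : (a + u.val) % n = (a + v.val) % n := congrArg Fin.val huv
    have h : u.val % n = v.val % n := Nat.ModEq.add_left_cancel' a h
    rw [Nat.mod_eq_of_lt (by omega), Nat.mod_eq_of_lt (by omega)] at h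
    exact Fin.ext h
  let F : Copy (pathGraph (l + 1)) (cycleGraph n) := ⟨f, hf⟩
  refine ⟨F.toSubgraph, F.isoToSubgraph.isTree_iff.1 (isTree_pathGraph l), ?_, ?_⟩
  · intro j hj
    exact ⟨⟨j, by omega⟩, trivial, rfl⟩
  · intro e he
    induction e with | _ x y
    obtain ⟨u, v, huv, rfl, rfl⟩ := he
    rcases pathGraph_adj.1 huv with h | h
    · refine ⟨u, by omega, ?_⟩
      rw [cycEdge, hsucc, add_assoc, h]
      rfl
    · refine ⟨v, by omega, ?_⟩
      rw [cycEdge, hsucc, add_assoc, h, Sym2.eq_swap]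
      rfl

/-- A coloring of the edges of the cycle for which every `k`-set lies on a rainbow arc
yields a `k`-rainbow coloring. -/
theorem exists_isRainbowColoring_of_arcs (hn : 3 ≤ n) {α : Type*} [Nonempty α] (g : Fin n → α)
    {k : ℕ}
    (h : ∀ S : Finset (Fin n), S.card = k → ∃ a l, l < n ∧
      (∀ v ∈ S, ∃ j ≤ l, v.val = (a + j) % n) ∧
      ∀ i < l, ∀ j < l, g (Fin.ofNat n (a + i)) = g (Fin.ofNat n (a + j)) → i = j) :
    ∃ c : Sym2 (Fin n) → α, IsRainbowColoring (cycleGraph n) k c := by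
  have hc : ∀ i, Function.extend cycEdge g (fun _ => Classical.arbitrary α) (cycEdge i) = g i :=
    fun i => (cycEdge_injective hn).extend_apply _ _ _
  refine ⟨Function.extend cycEdge g fun _ => Classical.arbitrary α, fun S hS => ?_⟩
  obtain ⟨a, l, hl, hSl, hg⟩ := h S hS
  obtain ⟨T, hT, hverts, hedges⟩ := exists_arc_tree (by omega) a hl
  refine ⟨T, ⟨fun v hv => ?_, hT⟩, fun e he e' he' hee' => ?_⟩
  · obtain ⟨j, hj, hvj⟩ := hSl v hv
    rw [show v = Fin.ofNat n (a + j) from Fin.ext hvj]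
    exact hverts j hj
  · obtain ⟨i, hi, rfl⟩ := hedges e he
    obtain ⟨j, hj, rfl⟩ := hedges e' he'
    rw [hc, hc] at hee'
    rw [hg i hi j hj hee']

/-- With `n - 1` colors, every vertex set of the cycle can be joined by a rainbow path. -/
theorem exists_isRainbowColoring_sub_one (hn : 3 ≤ n) (k : ℕ) :
    ∃ c : Sym2 (Fin n) → Fin (n - 1), IsRainbowColoring (cycleGraph n) k c := by
  have : NeZero (n - 1) := ⟨by omega⟩
  refine exists_isRainbowColoring_of_arcs hn (fun i => Fin.ofNat (n - 1) i.val) fun S _ =>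
    ⟨0, n - 1, by omega, fun v _ => ⟨v, by omega, ?_⟩, fun i hi j hj h => ?_⟩
  · rw [zero_add, Nat.mod_eq_of_lt v.isLt]
  · have h : (0 + i) % n % (n - 1) = (0 + j) % n % (n - 1) := congrArg Fin.val h
    rwa [zero_add, zero_add, Nat.mod_eq_of_lt (show i < n by omega),
      Nat.mod_eq_of_lt (show j < n by omega), Nat.mod_eq_of_lt hi, Nat.mod_eq_of_lt hj] at h

/-- With `n - 2` colors, every three vertices of the cycle can be joined by a rainbow path. -/
theorem exists_isRainbowColoring_three_sub_two (hn : 4 ≤ n) :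
    ∃ c : Sym2 (Fin n) → Fin (n - 2), IsRainbowColoring (cycleGraph n) 3 c := by
  have : NeZero (n - 2) := ⟨by omega⟩
  refine exists_isRainbowColoring_of_arcs (by omega) (fun i => Fin.ofNat (n - 2) i.val)
    fun S hS => ?_
  have inj : ∀ a ≤ 2, ∀ i < n - 2, ∀ j < n - 2,
      Fin.ofNat (n - 2) (Fin.ofNat n (a + i)).val = Fin.ofNat (n - 2) (Fin.ofNat n (a + j)).val →
      i = j := by
    intro a ha i hi j hj h
    have h : (a + i) % n % (n - 2) = (a + j) % n % (n - 2) := congrArg Fin.val h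
    rw [Nat.mod_eq_of_lt (show a + i < n by omega), Nat.mod_eq_of_lt (show a + j < n by omega)] at h
    have h : i % (n - 2) = j % (n - 2) := Nat.ModEq.add_left_cancel' a h
    rwa [Nat.mod_eq_of_lt hi, Nat.mod_eq_of_lt hj] at h
  by_cases h0 : (⟨0, by omega⟩ : Fin n) ∈ S
  swap
  · refine ⟨1, n - 2, by omega, fun v hv => ?_, inj 1 (by omega)⟩
    have hv0 : v.val ≠ 0 := fun h => h0 (by convert hv; exact h.symm)
    exact ⟨v - 1, by omega, by rw [Nat.mod_eq_of_lt] <;> omega⟩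
  by_cases hl : (⟨n - 1, by omega⟩ : Fin n) ∈ S
  swap
  · refine ⟨0, n - 2, by omega, fun v hv => ?_, inj 0 (by omega)⟩
    have hv0 : v.val ≠ n - 1 := fun h => hl (by convert hv; exact h.symm)
    exact ⟨v, by omega, by rw [Nat.mod_eq_of_lt] <;> omega⟩
  by_cases h1 : (⟨1, by omega⟩ : Fin n) ∈ S
  swap
  · refine ⟨2, n - 2, by omega, fun v hv => ?_, inj 2 (by omega)⟩
    have hv1 : v.val ≠ 1 := fun h => h1 (by convert hv; exact h.symm)
    by_cases hv0 : v.val = 0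
    · exact ⟨n - 2, le_rfl, by rw [show 2 + (n - 2) = n by omega, Nat.mod_self, hv0]⟩
    · exact ⟨v - 2, by omega, by rw [Nat.mod_eq_of_lt] <;> omega⟩
  have hSeq : ({⟨0, by omega⟩, ⟨n - 1, by omega⟩, ⟨1, by omega⟩} : Finset (Fin n)) = S := by
    refine Finset.eq_of_subset_of_card_le ?_ ?_
    · simp only [Finset.insert_subset_iff, Finset.singleton_subset_iff]
      exact ⟨h0, hl, h1⟩
    · rw [hS, Finset.card_eq_three.2 ⟨_, _, _, ?_, ?_, ?_, rfl⟩] <;>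
        simp only [ne_eq, Fin.mk.injEq] <;> omega
  have e1 : (n - 1 + 1) % n = 0 := by rw [Nat.sub_add_cancel (by omega), Nat.mod_self]
  refine ⟨n - 1, 2, by omega, fun v hv => ?_, fun i hi j hj h => ?_⟩
  · simp only [← hSeq, Finset.mem_insert, Finset.mem_singleton] at hv
    rcases hv with rfl | rfl | rfl
    · exact ⟨1, by omega, e1.symm⟩
    · exact ⟨0, by omega, by rw [Nat.mod_eq_of_lt] <;> simp; omega⟩
    · refine ⟨2, le_rfl, ?_⟩
      rw [show n - 1 + 2 = 1 + n by omega, Nat.add_mod_right, Nat.mod_eq_of_lt (by omega)]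
  · have h : (n - 1 + i) % n % (n - 2) = (n - 1 + j) % n % (n - 2) := congrArg Fin.val h
    have c0 : (n - 1 + 0) % n % (n - 2) = 1 := by
      rw [Nat.add_zero, Nat.mod_eq_of_lt (show n - 1 < n by omega),
        show n - 1 = 1 + (n - 2) by omega, Nat.add_mod_right, Nat.mod_eq_of_lt (by omega)]
    have c1 : (n - 1 + 1) % n % (n - 2) = 0 := by rw [e1, Nat.zero_mod]
    interval_cases i <;> interval_cases j <;> omega

open Finset in
/-- A coloring of the edges of the cycle with a color used three times is not `k`-rainbow
for any `k ≥ 3`. -/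
theorem not_isRainbowColoring_of_three_le_card_fiber {α : Type*} [DecidableEq α] {k : ℕ}
    (hk : 3 ≤ k) (hkn : k ≤ n) {c : Sym2 (Fin n) → α} {b : α}
    (hb : 3 ≤ #{i : Fin n | c (cycEdge i) = b}) :
    ¬ IsRainbowColoring (cycleGraph n) k c := by
  obtain ⟨R, hR, hR3⟩ := exists_subset_card_eq hb
  refine not_isRainbowColoring_of_card_image_add_two (by omega) hkn R (by omega) ?_
  have : #(R.image fun i => c (cycEdge i)) ≤ #{b} :=
    card_le_card (image_subset_iff.2 fun i hi => by simpa using hR hi)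
  rw [card_singleton] at this
  omega

open Finset in
/-- A `3`-rainbow coloring of the cycle uses at least `n - 2` colors. -/
theorem sub_two_le_of_isRainbowColoring_three (hn : 3 ≤ n) {m : ℕ} {c : Sym2 (Fin n) → Fin m}
    (hc : IsRainbowColoring (cycleGraph n) 3 c) : n - 2 ≤ m := by
  by_contra! hm
  rcases exists_three_or_card_two fun i : Fin n => c (cycEdge i) with ⟨b, hb⟩ | hD
  · exact not_isRainbowColoring_of_three_le_card_fiber le_rfl hn hb hc
  · rw [Fintype.card_fin, Fintype.card_fin] at hD
    obtain ⟨D, hsub, hD3⟩ := exists_subset_card_eq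
      (Nat.le_of_add_le_add_left ((show m + 3 ≤ n by omega).trans hD))
    have hcard := card_preimage_of_fiber_two (fun i : Fin n => c (cycEdge i)) D
      fun b hb => (mem_filter.1 (hsub hb)).2
    refine not_isRainbowColoring_three_of_six hn _ (hcard.trans (by rw [hD3])) ?_ hc
    rw [← hD3]
    exact card_le_card (image_subset_iff.2 fun i hi => (mem_filter.1 hi).2)

open Finset in
/-- A `k`-rainbow coloring of the cycle with `k ≥ 4` uses at least `n - 1` colors. -/
theorem sub_one_le_of_isRainbowColoring {k : ℕ} (hk : 4 ≤ k) (hkn : k ≤ n) {m : ℕ}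
    {c : Sym2 (Fin n) → Fin m} (hc : IsRainbowColoring (cycleGraph n) k c) : n - 1 ≤ m := by
  by_contra! hm
  rcases exists_three_or_card_two fun i : Fin n => c (cycEdge i) with ⟨b, hb⟩ | hD
  · exact not_isRainbowColoring_of_three_le_card_fiber (by omega) hkn hb hc
  · rw [Fintype.card_fin, Fintype.card_fin] at hD
    obtain ⟨D, hsub, hD2⟩ := exists_subset_card_eq
      (Nat.le_of_add_le_add_left ((show m + 2 ≤ n by omega).trans hD))
    have hcard := card_preimage_of_fiber_two (fun i : Fin n => c (cycEdge i)) D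
      fun b hb => (mem_filter.1 (hsub hb)).2
    rw [hD2] at hcard
    refine not_isRainbowColoring_of_card_image_add_two (by omega) hkn _
      (hcard.le.trans hk) ?_ hc
    rw [hcard]
    have : #(image (fun i : Fin n => c (cycEdge i)) {i | c (cycEdge i) ∈ D}) ≤ #D :=
      card_le_card (image_subset_iff.2 fun i hi => (mem_filter.1 hi).2)
    omega

end Cycle

theorem rxIndex_eq {V : Type*} {G : SimpleGraph V} {k N : ℕ}
    (hex : ∃ c : Sym2 V → Fin N, IsRainbowColoring G k c)
    (hle : ∀ (m : ℕ) (c : Sym2 V → Fin m), IsRainbowColoring G k c → N ≤ m) :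
    rxIndex G k = N :=
  le_antisymm (Nat.sInf_le hex) (le_csInf ⟨N, hex⟩ fun m ⟨c, hc⟩ => hle m c hc)

end RainbowIndex

open RainbowIndex in
/-- For integers `k` and `n` with `3 ≤ k ≤ n`: `rx_k(C_n) = n − 2` if `k = 3` and `n ≥ 4`,
and `rx_k(C_n) = n − 1` if `k = n = 3` or `4 ≤ k ≤ n`. -/
theorem stmt_2 (k n : ℕ) (hk : 3 ≤ k) (hkn : k ≤ n) :
    (k = 3 ∧ 4 ≤ n → rxIndex (cycleGraph n) k = n - 2) ∧
    ((k = 3 ∧ n = 3) ∨ 4 ≤ k → rxIndex (cycleGraph n) k = n - 1) := by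
  have : NeZero n := ⟨by omega⟩
  constructor
  · rintro ⟨rfl, hn⟩
    exact rxIndex_eq (exists_isRainbowColoring_three_sub_two hn)
      fun m c hc => sub_two_le_of_isRainbowColoring_three hkn hc
  · intro h
    refine rxIndex_eq (exists_isRainbowColoring_sub_one (by omega) k) fun m c hc => ?_
    rcases h with ⟨rfl, rfl⟩ | hk4
    · by_contra! hm
      refine not_isRainbowColoring_of_card_image_add_two le_rfl le_rfl Finset.univ (by simp) ?_ hc
      have := Finset.card_le_univ (Finset.univ.image fun i : Fin 3 => c (cycEdge i))
      rw [Fintype.card_fin] at this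
      rw [Finset.card_univ, Fintype.card_fin]
      omega
    · exact sub_one_le_of_isRainbowColoring hk4 hkn hc
end

section
/- The 3-rainbow index of the complete graph K_n satisfies: rx_3(K_n) = 2 if 3 ≤ n ≤ 5, and rx_3(K_n) = 3 if n ≥ 6. -/
open SimpleGraph

namespace RainbowIndex

variable {V : Type*} {G : SimpleGraph V}

lemma coe_isTree_iff [Finite V] (T : G.Subgraph) :
    T.coe.IsTree ↔ T.Connected ∧ T.edgeSet.ncard + 1 = T.verts.ncard := by
  rw [isTree_iff_connected_and_card, ← Subgraph.connected_iff', ← T.image_coe_edgeSet_coe,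
    Set.ncard_image_of_injective _ (Sym2.map.injective Subtype.val_injective),
    Nat.card_coe_set_eq, Nat.card_coe_set_eq]

lemma coe_toSubgraph_isTree [Finite V] {u v : V} {p : G.Walk u v} (hp : p.IsPath) :
    p.toSubgraph.coe.IsTree := by
  classical
  refine (coe_isTree_iff _).2 ⟨p.toSubgraph_connected, ?_⟩
  have hv : p.toSubgraph.verts = (p.support.toFinset : Set V) := by
    ext; simp
  have he : p.toSubgraph.edgeSet = (p.edges.toFinset : Set (Sym2 V)) := by
    ext; simp
  rw [hv, he, Set.ncard_coe_finset, Set.ncard_coe_finset,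
    List.toFinset_card_of_nodup hp.support_nodup,
    List.toFinset_card_of_nodup hp.isTrail.edges_nodup, p.length_edges, p.length_support]

/-- A path whose edge colors are pairwise distinct is a rainbow tree for every set of
vertices on it. -/
lemma exists_rainbow_tree_of_path [Finite V] {α : Type*} {c : Sym2 V → α} {S : Finset V}
    {u v : V} {p : G.Walk u v} (hp : p.IsPath) (hS : ∀ x ∈ S, x ∈ p.support)
    (hc : (p.edges.map c).Nodup) :
    ∃ T : G.Subgraph, IsSTree G (S : Set V) T ∧ Set.InjOn c T.edgeSet := by
  refine ⟨p.toSubgraph, ⟨fun x hx => by simpa using hS x hx, coe_toSubgraph_isTree hp⟩, ?_⟩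
  intro e he f hf h
  simp only [Walk.mem_edges_toSubgraph] at he hf
  exact List.inj_on_of_nodup_map hc he hf h

lemma exists_rainbow_tree_of_ne [Finite V] [DecidableEq V] {α : Type*} {c : Sym2 V → α}
    {x y z : V} (hxy : x ≠ y) (hxz : x ≠ z) (hyz : y ≠ z) (h : c s(x, y) ≠ c s(y, z)) :
    ∃ T : (completeGraph V).Subgraph,
      IsSTree _ (({x, y, z} : Finset V) : Set V) T ∧ Set.InjOn c T.edgeSet := by
  let p : (completeGraph V).Walk x z := .cons hxy (.cons hyz .nil)
  exact exists_rainbow_tree_of_path (p := p) (by simp [p, hxy, hxz, hyz]) (by simp [p])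
    (by simp [p, h])

/-- A coloring of a complete graph is 3-rainbow if every monochromatic triangle `x y z` admits
a rainbow path on its vertices and one further vertex `w`, second on the path. -/
lemma isRainbowColoring_of_mono [Finite V] [DecidableEq V] {α : Type*} {c : Sym2 V → α}
    (h : ∀ x y z : V, x ≠ y → x ≠ z → y ≠ z → c s(x, y) = c s(y, z) → c s(x, z) = c s(y, z) →
      ∃ x' w y' z' : V, ({x, y, z} : Finset V) = {x', y', z'} ∧ [x', w, y', z'].Nodup ∧
        [c s(x', w), c s(w, y'), c s(y', z')].Nodup) :
    IsRainbowColoring (completeGraph V) 3 c := by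
  intro S hS
  obtain ⟨x, y, z, hxy, hxz, hyz, rfl⟩ := Finset.card_eq_three.1 hS
  by_cases h₁ : c s(x, y) = c s(y, z)
  · by_cases h₂ : c s(x, z) = c s(y, z)
    · obtain ⟨x', w, y', z', hS, hd, hc⟩ := h x y z hxy hxz hyz h₁ h₂
      rw [hS]
      simp only [List.nodup_cons, List.mem_cons, List.not_mem_nil, not_or, or_false] at hd
      obtain ⟨⟨h₁, h₂, h₃⟩, ⟨h₄, h₅⟩, h₆, -⟩ := hd
      let p : (completeGraph V).Walk x' z' := .cons h₁ (.cons h₄ (.cons h₆ .nil))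
      exact exists_rainbow_tree_of_path (p := p) (by simp [p, *]) (by simp [p])
        (by simpa [p] using hc)
    · have hS : ({x, y, z} : Finset V) = {x, z, y} := by grind
      rw [hS]
      exact exists_rainbow_tree_of_ne hxz hxy hyz.symm (by rwa [Sym2.eq_swap (a := z)])
  · exact exists_rainbow_tree_of_ne hxy hxz hyz h₁

/-- The two color classes of this coloring of `K_5` are 5-cycles; smaller complete graphs are
colored by restriction. -/
def pentagonColoring (n : ℕ) : Sym2 (Fin n) → Fin 2 :=
  Sym2.lift ⟨fun a b => if (a.val + 1) % 5 = b.val ∨ (b.val + 1) % 5 = a.val then 0 else 1,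
    fun a b => by simp only [or_comm]⟩

lemma pentagonColoring_isRainbow {n : ℕ} (hn : n ≤ 5) :
    IsRainbowColoring (completeGraph (Fin n)) 3 (pentagonColoring n) := by
  apply isRainbowColoring_of_mono
  intro x y z hxy hxz hyz h₁ h₂
  exfalso
  revert x y z
  interval_cases n <;> decide

/-- Color `0` joins numbers of equal parity, color `1` joins `2i` to `2i + 1`, and color `2` is
used for all other pairs. -/
def matchingColoring (n : ℕ) : Sym2 (Fin n) → Fin 3 :=
  Sym2.lift ⟨fun a b => if a.val % 2 = b.val % 2 then 0 else
    if a.val / 2 = b.val / 2 then 1 else 2, fun a b => by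
      simp only [eq_comm (a := a.val % 2), eq_comm (a := a.val / 2)]⟩

lemma matchingColoring_mk {n : ℕ} (a b : Fin n) :
    matchingColoring n s(a, b) = if a.val % 2 = b.val % 2 then 0 else
      if a.val / 2 = b.val / 2 then 1 else 2 := rfl

lemma exists_matchingColoring_rainbow_path {n : ℕ} {x y z : Fin n} (hxy : x < y) (hyz : y ≠ z)
    (hxz : x ≠ z) (h₁ : x.val % 2 = y.val % 2) (h₂ : y.val % 2 = z.val % 2) :
    ∃ w, [x, w, y, z].Nodup ∧ [matchingColoring n s(x, w), matchingColoring n s(w, y),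
      matchingColoring n s(y, z)].Nodup := by
  have hw : 2 * (x.val / 2) + (1 - x.val % 2) < n := by omega
  refine ⟨⟨_, hw⟩, ?_, ?_⟩
  · simp [Fin.ext_iff] at *
    omega
  · simp only [matchingColoring_mk]
    rw [if_neg (by omega), if_pos (by omega), if_neg (by omega), if_neg (by omega), if_pos h₂]
    decide

lemma matchingColoring_isRainbow (n : ℕ) :
    IsRainbowColoring (completeGraph (Fin n)) 3 (matchingColoring n) := by
  apply isRainbowColoring_of_mono
  intro x y z hxy hxz hyz h₁ h₂
  have hp : x.val % 2 = y.val % 2 ∧ y.val % 2 = z.val % 2 := by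
    simp only [matchingColoring_mk] at h₁ h₂
    split_ifs at h₁ h₂ <;> omega
  obtain h | h := hxy.lt_or_gt
  · obtain ⟨w, hw⟩ := exists_matchingColoring_rainbow_path h hyz hxz hp.1 hp.2
    exact ⟨x, w, y, z, rfl, hw⟩
  · obtain ⟨w, hw⟩ := exists_matchingColoring_rainbow_path h hxz hyz hp.1.symm (hp.1.trans hp.2)
    exact ⟨y, w, x, z, Finset.insert_comm .., hw⟩

lemma ncard_verts_le [Finite V] {m : ℕ} {c : Sym2 V → Fin m} {T : G.Subgraph}
    (hT : T.coe.IsTree) (hc : Set.InjOn c T.edgeSet) : T.verts.ncard ≤ m + 1 := by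
  rw [← ((coe_isTree_iff T).1 hT).2, ← hc.ncard_image]
  simpa using Set.ncard_le_card (c '' T.edgeSet)

lemma le_of_isRainbowColoring [Fintype V] {m k : ℕ} {c : Sym2 V → Fin m}
    (hk : k ≤ Fintype.card V) (hc : IsRainbowColoring G k c) : k ≤ m + 1 := by
  obtain ⟨S, -, hS⟩ := Finset.exists_subset_card_eq (s := (Finset.univ : Finset V)) hk
  obtain ⟨T, ⟨hST, hT⟩, hinj⟩ := hc S hS
  have h := Set.ncard_le_ncard hST
  rw [Set.ncard_coe_finset, hS] at h
  exact h.trans (ncard_verts_le hT hinj)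

/-- With two colors, a 3-rainbow coloring has no monochromatic triangle. -/
lemma not_mono_of_isRainbowColoring [Finite V] {c : Sym2 V → Fin 2}
    (hc : IsRainbowColoring G 3 c) {x y z : V} (hxy : x ≠ y) (hxz : x ≠ z) (hyz : y ≠ z)
    {k : Fin 2} (h₁ : c s(x, y) = k) (h₂ : c s(x, z) = k) (h₃ : c s(y, z) = k) : False := by
  classical
  have hS : ({x, y, z} : Finset V).card = 3 := Finset.card_eq_three.2 ⟨x, y, z, hxy, hxz, hyz, rfl⟩
  obtain ⟨T, ⟨hST, hT⟩, hinj⟩ := hc _ hS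
  have hle := ncard_verts_le hT hinj
  have hverts := Set.eq_of_subset_of_ncard_le hST (by rwa [Set.ncard_coe_finset, hS])
  have hmono : ∀ e ∈ T.edgeSet, c e = k := by
    intro e
    induction e with
    | _ a b =>
      intro hab
      rw [Subgraph.mem_edgeSet] at hab
      have ha : a ∈ T.verts := hab.fst_mem
      have hb : b ∈ T.verts := hab.snd_mem
      have hne : a ≠ b := hab.ne
      rw [← hverts] at ha hb
      simp only [Finset.coe_insert, Finset.coe_singleton, Set.mem_insert_iff,
        Set.mem_singleton_iff] at ha hb
      grind [Sym2.eq_swap]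
  have hone : T.edgeSet.ncard ≤ 1 :=
    (Set.ncard_le_one (Set.toFinite _)).2 fun e he f hf => hinj he hf ((hmono e he).trans (hmono f hf).symm)
  have hcard := ((coe_isTree_iff T).1 hT).2
  rw [← hverts, Set.ncard_coe_finset, hS] at hcard
  omega

/-- `R(3,3) ≤ 6`, for edge colorings. -/
lemma exists_mono_triangle [Fintype V] (hV : 6 ≤ Fintype.card V) (c : Sym2 V → Fin 2) :
    ∃ (x y z : V) (k : Fin 2), x ≠ y ∧ x ≠ z ∧ y ≠ z ∧
      c s(x, y) = k ∧ c s(x, z) = k ∧ c s(y, z) = k := by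
  classical
  obtain ⟨v⟩ : Nonempty V := Fintype.card_pos_iff.1 (by omega)
  obtain ⟨k, -, hk⟩ := Finset.exists_lt_card_fiber_of_mul_lt_card_of_maps_to
    (s := Finset.univ.erase v) (t := Finset.univ) (f := fun w => c s(v, w)) (n := 2)
    (fun _ _ => Finset.mem_univ _) (by simp; omega)
  obtain ⟨x, y, z, hx, hy, hz, hxy, hxz, hyz⟩ := Finset.two_lt_card_iff.1 hk
  simp only [Finset.mem_filter, Finset.mem_erase, Finset.mem_univ, and_true] at hx hy hz
  by_cases h₁ : c s(x, y) = k
  · exact ⟨v, x, y, k, hx.1.symm, hy.1.symm, hxy, hx.2, hy.2, h₁⟩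
  by_cases h₂ : c s(x, z) = k
  · exact ⟨v, x, z, k, hx.1.symm, hz.1.symm, hxz, hx.2, hz.2, h₂⟩
  by_cases h₃ : c s(y, z) = k
  · exact ⟨v, y, z, k, hy.1.symm, hz.1.symm, hyz, hy.2, hz.2, h₃⟩
  exact ⟨x, y, z, c s(x, y), hxy, hxz, hyz, rfl, by omega, by omega⟩

end RainbowIndex

open RainbowIndex in
/-- `rx_3(K_n) = 2` if `3 ≤ n ≤ 5`, and `rx_3(K_n) = 3` if `n ≥ 6`. -/
theorem stmt_3 (n : ℕ) :
    (3 ≤ n ∧ n ≤ 5 → rxIndex (completeGraph (Fin n)) 3 = 2) ∧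
    (6 ≤ n → rxIndex (completeGraph (Fin n)) 3 = 3) := by
  refine ⟨fun ⟨h3, h5⟩ => ?_, fun h6 => ?_⟩
  · refine IsLeast.csInf_eq ⟨⟨_, pentagonColoring_isRainbow h5⟩, ?_⟩
    rintro m ⟨c, hc⟩
    have := le_of_isRainbowColoring (by simpa using h3) hc
    omega
  · refine IsLeast.csInf_eq ⟨⟨_, matchingColoring_isRainbow n⟩, ?_⟩
    rintro m ⟨c, hc⟩
    have hm := le_of_isRainbowColoring (by simp; omega) hc
    obtain rfl | hm : m = 2 ∨ 3 ≤ m := by omega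
    · obtain ⟨x, y, z, k, hxy, hxz, hyz, h₁, h₂, h₃⟩ := exists_mono_triangle (by simpa using h6) c
      exact (not_mono_of_isRainbowColoring hc hxy hxz hyz h₁ h₂ h₃).elim
    · exact hm
end

section
/- Let G be a connected graph, c a vertex of G, and i ≥ 1 an integer with i + 1 ≤ ecc(c). Let S_i = N_G^i[c] be the set of vertices at distance at most i from c. Then rx_3(G[S_i ∪ N_G^{i+1}(c)]) ≤ rx_3(G[S_i]) + α_{i+1}^0(G,c) + 3, where α_{i+1}^0(G,c) is the maximum size of an independent set of G contained in N_G^{i+1}(c). -/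
open SimpleGraph

namespace RainbowIndex

/-- Some connected subgraph of `H` contains `W`, has pairwise distinct edge colors, and uses only
colors from `K`. -/
def RainbowLinked {X C : Type*} (H : SimpleGraph X) (F : Sym2 X → C) (W : Set X) (K : Set C) :
    Prop :=
  ∃ T : H.Subgraph, T.Connected ∧ W ⊆ T.verts ∧ Set.InjOn F T.edgeSet ∧
    Set.MapsTo F T.edgeSet K

section Linked

variable {X C : Type*} {H : SimpleGraph X} {F : Sym2 X → C} {W : Set X} {K : Set C}

lemma RainbowLinked.mono {W' : Set X} {K' : Set C} (h : RainbowLinked H F W K) (hW : W' ⊆ W)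
    (hK : K ⊆ K') : RainbowLinked H F W' K' := by
  obtain ⟨T, h1, h2, h3, h4⟩ := h
  exact ⟨T, h1, hW.trans h2, h3, h4.mono_right hK⟩

lemma RainbowLinked.singleton (x : X) : RainbowLinked H F {x} ∅ :=
  ⟨H.singletonSubgraph x, Subgraph.singletonSubgraph_connected, by simp, by simp, by
    simp [Set.MapsTo]⟩

lemma RainbowLinked.insert {u v : X} (h : RainbowLinked H F W K) (hu : u ∈ W) (huv : H.Adj u v)
    (hF : F s(u, v) ∉ K) : RainbowLinked H F (insert v W) (insert (F s(u, v)) K) := by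
  obtain ⟨T, h1, h2, h3, h4⟩ := h
  refine ⟨T ⊔ H.subgraphOfAdj huv, Subgraph.connected_sup h1.preconnected
    (Subgraph.subgraphOfAdj_connected huv).preconnected ⟨u, h2 hu, by simp⟩, ?_, ?_, ?_⟩
  · rintro x (rfl | hx)
    · right; simp
    · exact Or.inl (h2 hx)
  · rw [Subgraph.edgeSet_sup, edgeSet_subgraphOfAdj, Set.union_singleton]
    intro a ha b hb hab
    rcases ha with rfl | ha <;> rcases hb with rfl | hb
    · rfl
    · exact absurd (hab ▸ h4 hb) hF
    · exact absurd (hab ▸ h4 ha) hF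
    · exact h3 ha hb hab
  · rw [Subgraph.edgeSet_sup, edgeSet_subgraphOfAdj, Set.union_singleton]
    rintro a (rfl | ha)
    · exact Or.inl rfl
    · exact Or.inr (h4 ha)

lemma exists_spanning_tree {T : H.Subgraph} (hT : T.Connected) :
    ∃ T' : H.Subgraph, T' ≤ T ∧ T'.verts = T.verts ∧ T'.coe.IsTree := by
  obtain ⟨R, hR, hRt⟩ := hT.coe.exists_isTree_le
  refine ⟨{ verts := T.verts
            Adj := fun a b => ∃ (ha : a ∈ T.verts) (hb : b ∈ T.verts), R.Adj ⟨a, ha⟩ ⟨b, hb⟩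
            adj_sub := fun ⟨_, _, h⟩ => T.adj_sub (hR h)
            edge_vert := fun ⟨ha, _, _⟩ => ha
            symm := ⟨fun _ _ ⟨ha, hb, h⟩ => ⟨hb, ha, h.symm⟩⟩ },
    ⟨subset_rfl, fun _ _ ⟨_, _, h⟩ => hR h⟩, rfl, ?_⟩
  convert hRt
  ext ⟨a, ha⟩ ⟨b, hb⟩
  exact ⟨fun ⟨_, _, h⟩ => h, fun h => ⟨ha, hb, h⟩⟩

lemma RainbowLinked.exists_isSTree (h : RainbowLinked H F W K) :
    ∃ T : H.Subgraph, IsSTree H W T ∧ Set.InjOn F T.edgeSet := by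
  obtain ⟨T, h1, h2, h3, -⟩ := h
  obtain ⟨T', hle, hv, ht⟩ := exists_spanning_tree h1
  exact ⟨T', ⟨hv ▸ h2, ht⟩, h3.mono (Subgraph.edgeSet_mono hle)⟩

lemma isRainbowColoring_three_of_linked
    (h : ∀ a b d : X, a ≠ b → a ≠ d → b ≠ d → ∃ K, RainbowLinked H F {a, b, d} K) :
    IsRainbowColoring H 3 F := by
  classical
  intro S hS
  obtain ⟨a, b, d, hab, had, hbd, rfl⟩ := Finset.card_eq_three.mp hS
  obtain ⟨K, hK⟩ := h a b d hab had hbd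
  simpa using hK.exists_isSTree

lemma rxIndex_le_of_isRainbowColoring {k : ℕ} (hF : IsRainbowColoring H k F) (K : Finset C)
    (hne : K.Nonempty) (hK : ∀ e ∈ H.edgeSet, F e ∈ K) : rxIndex H k ≤ K.card := by
  classical
  obtain ⟨x0, hx0⟩ := hne
  let g : C → Fin K.card := fun x => if h : x ∈ K then K.equivFin ⟨x, h⟩ else K.equivFin ⟨x0, hx0⟩
  have hg : Set.InjOn g K := by
    intro a ha b hb hab
    have ha' : a ∈ K := ha
    have hb' : b ∈ K := hb
    simpa [g, ha', hb'] using hab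
  refine Nat.sInf_le ⟨g ∘ F, fun S hS => ?_⟩
  obtain ⟨T, hT, hi⟩ := hF S hS
  exact ⟨T, hT, hg.comp hi fun e he => hK e (T.edgeSet_subset he)⟩

lemma exists_isRainbowColoring_rxIndex [Finite X] (hH : H.Connected) (k : ℕ) :
    ∃ f : Sym2 X → Fin (rxIndex H k), IsRainbowColoring H k f := by
  have : Finite (Sym2 X) := inferInstance
  obtain ⟨n, ⟨e⟩⟩ := Finite.exists_equiv_fin (Sym2 X)
  have hne : {n | ∃ c : Sym2 X → Fin n, IsRainbowColoring H k c}.Nonempty := by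
    refine ⟨n, e, fun S _ => ?_⟩
    refine RainbowLinked.exists_isSTree (K := Set.univ) ⟨⊤, ?_, by simp, e.injective.injOn, by
      simp [Set.MapsTo]⟩
    exact ⟨(Subgraph.topIso.connected_iff).mpr hH⟩
  exact Nat.sInf_mem hne

/-- A `3`-rainbow coloring also connects any (not necessarily distinct) three vertices. -/
lemma exists_connected_of_isRainbowColoring [Finite X] (hH : H.Connected)
    (hF : IsRainbowColoring H 3 F) (a b d : X) :
    ∃ T : H.Subgraph, T.Connected ∧ {a, b, d} ⊆ T.verts ∧ Set.InjOn F T.edgeSet := by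
  classical
  have := Fintype.ofFinite X
  by_cases hX : 3 ≤ Fintype.card X
  · obtain ⟨S, hS, hc⟩ := Finset.exists_superset_card_eq (s := {a, b, d}) Finset.card_le_three hX
    obtain ⟨T, ⟨hT, ht⟩, hi⟩ := hF S hc
    refine ⟨T, ⟨ht.1⟩, ?_, hi⟩
    intro x hx
    exact hT (hS (by simpa using hx))
  · refine ⟨⊤, ⟨(Subgraph.topIso.connected_iff).mpr hH⟩, by simp, ?_⟩
    have key : ∀ x y z : X, x ≠ y → z = x ∨ z = y := by
      intro x y z hxy
      by_contra! h
      apply hX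
      rw [← Finset.card_eq_three.mpr ⟨z, x, y, h.1, h.2, hxy, rfl⟩]
      exact Finset.card_le_univ _
    intro e he e' he' _
    induction e with | _ x y
    induction e' with | _ z w
    have h1 : x ≠ y := H.ne_of_adj (by simpa using he)
    have h2 : z ≠ w := H.ne_of_adj (by simpa using he')
    have := key x y z h1
    have := key x y w h1
    simp only [Sym2.eq_iff]
    grind

end Linked

/-- A finite clique can be edge-colored with three colors such that any three of its vertices lie
on a rainbow path with at most three edges. -/
lemma exists_clique_coloring {X : Type*} (Q : Finset X) :
    ∃ κ : Sym2 X → Fin 3, ∀ u ∈ Q, ∀ v ∈ Q, ∀ w ∈ Q, u ≠ v → u ≠ w → v ≠ w →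
      ∃ a ∈ Q, ∃ b ∈ Q, ∃ d ∈ Q, ∃ e ∈ Q, a ≠ b ∧ b ≠ d ∧ κ s(a, b) ≠ κ s(b, d) ∧
        (({u, v, w} : Set X) ⊆ {a, b, d} ∨
          ({u, v, w} : Set X) ⊆ {a, b, d, e} ∧ d ≠ e ∧ κ s(d, e) ≠ κ s(a, b) ∧
            κ s(d, e) ≠ κ s(b, d)) := by
  classical
  obtain ⟨idx, hinj, hsurj⟩ : ∃ idx : X → ℕ, (∀ a ∈ Q, ∀ b ∈ Q, idx a = idx b → a = b) ∧
      ∀ a ∈ Q, ∀ n ≤ idx a, ∃ b ∈ Q, idx b = n := by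
    refine ⟨fun x => if h : x ∈ Q then Q.equivFin ⟨x, h⟩ else 0, ?_, ?_⟩
    · intro a ha b hb hab
      simpa [ha, hb, Fin.val_inj] using hab
    · intro a ha n hn
      simp only [ha, dite_true] at hn
      have hn' : n < Q.card := hn.trans_lt (Fin.isLt _)
      refine ⟨Q.equivFin.symm ⟨n, hn'⟩, Finset.coe_mem _, ?_⟩
      simp
  let pc : ℕ → ℕ → Fin 3 := fun i j => if i % 2 = 1 then 2 else if j = i + 1 then 0 else 1
  let κ : Sym2 X → Fin 3 := Sym2.lift ⟨fun a b => pc (min (idx a) (idx b)) (max (idx a) (idx b)),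
    fun a b => by simp only [min_comm, max_comm]⟩
  have hκ : ∀ a b, idx a < idx b → κ s(a, b) = pc (idx a) (idx b) := by
    intro a b h
    simp [κ, h.le]
  have hκ' : ∀ a b, idx b < idx a → κ s(a, b) = pc (idx b) (idx a) := by
    intro a b h
    simp [κ, h.le]
  have ordered : ∀ u ∈ Q, ∀ v ∈ Q, ∀ w ∈ Q, idx u < idx v → idx v < idx w →
      ∃ a ∈ Q, ∃ b ∈ Q, ∃ d ∈ Q, ∃ e ∈ Q, a ≠ b ∧ b ≠ d ∧ κ s(a, b) ≠ κ s(b, d) ∧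
        (({u, v, w} : Set X) ⊆ {a, b, d} ∨
          ({u, v, w} : Set X) ⊆ {a, b, d, e} ∧ d ≠ e ∧ κ s(d, e) ≠ κ s(a, b) ∧
            κ s(d, e) ≠ κ s(b, d)) := by
    intro u hu v hv w hw huv hvw
    have huv' : u ≠ v := by rintro rfl; omega
    have huw' : u ≠ w := by rintro rfl; omega
    have hvw' : v ≠ w := by rintro rfl; omega
    by_cases h1 : κ s(u, v) ≠ κ s(v, w)
    · exact ⟨u, hu, v, hv, w, hw, w, hw, huv', hvw', h1, Or.inl subset_rfl⟩
    by_cases h2 : κ s(v, u) ≠ κ s(u, w)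
    · refine ⟨v, hv, u, hu, w, hw, w, hw, huv'.symm, huw', h2, Or.inl ?_⟩
      rw [Set.insert_comm]
    push Not at h1 h2
    obtain ⟨t, ht, hti⟩ : ∃ t ∈ Q, idx t = if idx u % 2 = 1 then idx u - 1 else idx u + 1 :=
      hsurj w hw _ (by split_ifs <;> omega)
    have hvt : idx t < idx v := by
      rw [hκ' _ _ huv, hκ _ _ (huv.trans hvw)] at h2
      simp only [pc] at h2
      grind
    rw [hκ _ _ huv, hκ _ _ hvw] at h1
    rw [hκ' _ _ huv, hκ _ _ (huv.trans hvw)] at h2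
    have htv := hκ _ _ hvt
    refine ⟨u, hu, t, ht, v, hv, w, hw, ?_, ?_, ?_, Or.inr ⟨?_, hvw', ?_, ?_⟩⟩
    · rintro rfl; split_ifs at hti <;> omega
    · rintro rfl; omega
    · rw [htv]
      by_cases hodd : idx u % 2 = 1
      · rw [hκ' u t (by rw [if_pos hodd] at hti; omega)]
        simp only [pc]; grind
      · rw [hκ u t (by rw [if_neg hodd] at hti; omega)]
        simp only [pc]; grind
    · intro x hx
      simp only [Set.mem_insert_iff, Set.mem_singleton_iff] at hx ⊢
      tauto
    · rw [hκ _ _ hvw]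
      by_cases hodd : idx u % 2 = 1
      · rw [hκ' u t (by rw [if_pos hodd] at hti; omega)]
        simp only [pc] at h1 h2 ⊢; grind
      · rw [hκ u t (by rw [if_neg hodd] at hti; omega)]
        simp only [pc] at h1 h2 ⊢; grind
    · rw [hκ _ _ hvw, htv]
      simp only [pc] at h1 h2 ⊢; grind
  refine ⟨κ, fun u hu v hv w hw huv huw hvw => ?_⟩
  have n1 : idx u ≠ idx v := fun h => huv (hinj _ hu _ hv h)
  have n2 : idx u ≠ idx w := fun h => huw (hinj _ hu _ hw h)
  have n3 : idx v ≠ idx w := fun h => hvw (hinj _ hv _ hw h)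
  have s1 : ({u, v, w} : Set X) = {u, w, v} := by grind
  have s2 : ({u, v, w} : Set X) = {v, u, w} := by grind
  have s3 : ({u, v, w} : Set X) = {v, w, u} := by grind
  have s4 : ({u, v, w} : Set X) = {w, u, v} := by grind
  have s5 : ({u, v, w} : Set X) = {w, v, u} := by grind
  rcases n1.lt_or_gt with h1 | h1 <;> rcases n2.lt_or_gt with h2 | h2 <;>
    rcases n3.lt_or_gt with h3 | h3
  · exact ordered u hu v hv w hw h1 h3
  · rw [s1]; exact ordered u hu w hw v hv h2 h3
  · omega
  · rw [s4]; exact ordered w hw u hu v hv h2 h1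
  · rw [s2]; exact ordered v hv u hu w hw h1 h2
  · omega
  · rw [s3]; exact ordered v hv w hw u hu h3 h2
  · rw [s5]; exact ordered w hw v hv u hu h3 h1

/-- Around a maximum independent set `M ⊆ N`, the set `N` splits into the set `P` of vertices with
two distinct neighbors `β v`, `γ v` in `M`, and into cliques indexed by `M` via `q`. -/
lemma exists_maximum_independent_partition {X : Type*} [Finite X] (H : SimpleGraph X)
    (N : Set X) :
    ∃ (M : Finset X) (P : Set X) (q β γ : X → X), (∀ x ∈ M, x ∈ N) ∧
      (M : Set X).Pairwise (fun u v => ¬ H.Adj u v) ∧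
      (∀ v ∈ P, v ∈ N ∧ β v ∈ M ∧ γ v ∈ M ∧ β v ≠ γ v ∧ H.Adj v (β v) ∧
        H.Adj v (γ v)) ∧
      (∀ v ∈ N, v ∉ P → q v ∈ M) ∧
      (∀ u ∈ N, ∀ v ∈ N, u ∉ P → v ∉ P → u ≠ v → q u = q v → H.Adj u v) ∧
      (∀ x ∈ M, x ∉ P ∧ q x = x) := by
  classical
  have := Fintype.ofFinite X
  obtain ⟨M, hM, hmax⟩ := Finset.exists_max_image
    (Finset.univ.filter fun M : Finset X =>
      (∀ x ∈ M, x ∈ N) ∧ (M : Set X).Pairwise (fun u v => ¬ H.Adj u v)) Finset.card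
    ⟨∅, by simp⟩
  simp only [Finset.mem_filter, Finset.mem_univ, true_and] at hM hmax
  obtain ⟨hMN, hind⟩ := hM
  have hdom : ∀ v ∈ N, v ∉ M → ∃ x ∈ M, H.Adj v x := by
    intro v hv hvM
    by_contra! h
    have := hmax (insert v M) ⟨by simpa [hv] using hMN, by
      rw [Finset.coe_insert, Set.pairwise_insert]
      exact ⟨hind, fun x hx _ => ⟨h x hx, fun h' => h x hx h'.symm⟩⟩⟩
    rw [Finset.card_insert_of_notMem hvM] at this
    omega
  let P : Set X := {v | (v ∈ N ∧ v ∉ M) ∧ ∃ x y, x ∈ M ∧ y ∈ M ∧ x ≠ y ∧ H.Adj v x ∧ H.Adj v y}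
  have hP : ∀ v, ∃ x y, v ∈ P → v ∈ N ∧ x ∈ M ∧ y ∈ M ∧ x ≠ y ∧ H.Adj v x ∧ H.Adj v y := by
    intro v
    by_cases hv : v ∈ P
    · obtain ⟨⟨hN, -⟩, x, y, h⟩ := hv
      exact ⟨x, y, fun _ => ⟨hN, h⟩⟩
    · exact ⟨v, v, fun h => absurd h hv⟩
  choose β γ hβγ using hP
  have hQ : ∀ v, ∃ x, (v ∈ M → x = v) ∧ (v ∈ N → v ∉ M → x ∈ M ∧ H.Adj v x) := by
    intro v
    by_cases hv : v ∈ M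
    · exact ⟨v, fun _ => rfl, fun _ h => absurd hv h⟩
    · by_cases hN : v ∈ N
      · obtain ⟨x, hx⟩ := hdom v hN hv
        exact ⟨x, fun h => absurd h hv, fun _ _ => hx⟩
      · exact ⟨v, fun _ => rfl, fun h => absurd h hN⟩
  choose q hq1 hq2 using hQ
  refine ⟨M, P, q, β, γ, hMN, hind, hβγ, ?_, ?_, fun x hx => ⟨fun h => h.1.2 hx, hq1 x hx⟩⟩
  · intro v hv _
    by_cases hvM : v ∈ M
    · rwa [hq1 v hvM]
    · exact (hq2 v hv hvM).1
  · intro u hu v hv huP hvP huv hquv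
    by_cases huM : u ∈ M
    · rw [hq1 u huM] at hquv
      have hvM : v ∉ M := fun h => huv (hquv.trans (hq1 v h))
      exact (hquv ▸ (hq2 v hv hvM).2).symm
    by_cases hvM : v ∈ M
    · rw [hq1 v hvM] at hquv
      exact hquv ▸ (hq2 u hu huM).2
    by_contra hadj
    have huniq : ∀ w ∈ N, w ∉ M → w ∉ P → ∀ x ∈ M, x ≠ q w → ¬ H.Adj w x :=
      fun w hw hwM hwP x hx hne hwx =>
        hwP ⟨⟨hw, hwM⟩, x, q w, hx, (hq2 w hw hwM).1, hne, hwx, (hq2 w hw hwM).2⟩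
    have hnu : u ∉ M.erase (q u) := fun h => huM (Finset.mem_of_mem_erase h)
    have hnv : v ∉ insert u (M.erase (q u)) := by
      simp only [Finset.mem_insert, not_or]
      exact ⟨huv.symm, fun h => hvM (Finset.mem_of_mem_erase h)⟩
    have := hmax (insert v (insert u (M.erase (q u)))) ⟨by
        intro x hx
        simp only [Finset.mem_insert, Finset.mem_erase] at hx
        rcases hx with rfl | rfl | hx
        exacts [hv, hu, hMN x hx.2], by
      rw [Finset.coe_insert, Finset.coe_insert, Set.pairwise_insert, Set.pairwise_insert]
      refine ⟨⟨hind.mono (by simp), fun x hx _ => ?_⟩, fun x hx _ => ?_⟩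
      · obtain ⟨hxM, hne⟩ : x ∈ M ∧ x ≠ q u := by simpa using hx
        have := huniq u hu huM huP x hxM hne
        exact ⟨this, fun h => this h.symm⟩
      · rcases hx with rfl | hx
        · exact ⟨fun h => hadj h.symm, hadj⟩
        · obtain ⟨hxM, hne⟩ : x ∈ M ∧ x ≠ q u := by simpa using hx
          have := huniq v hv hvM hvP x hxM (hquv ▸ hne)
          exact ⟨this, fun h => this h.symm⟩⟩
    rw [Finset.card_insert_of_notMem hnv, Finset.card_insert_of_notMem hnu,
      Finset.card_erase_of_mem (hq2 u hu huM).1] at this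
    have := Finset.card_pos.mpr ⟨_, (hq2 u hu huM).1⟩
    omega

/-- The edge-coloring extending `f` from `S`: edges between `S` and its complement are colored by
their outer end, edges between `P` and `M` by the colors `1` and `2`, and edges inside a class of
`q` by `κ`. -/
lemma exists_extended_coloring {X : Type*} {r : ℕ} (S P : Set X) (M : Finset X) (q β γ : X → X)
    (κ : X → Sym2 X → Fin 3) (f : Sym2 X → Fin r) (hMS : ∀ x ∈ M, x ∉ S)
    (hP : ∀ v ∈ P, v ∉ S ∧ β v ∈ M ∧ γ v ∈ M ∧ β v ≠ γ v)
    (hq : ∀ v ∉ S, v ∉ P → q v ∈ M) (hM : ∀ x ∈ M, x ∉ P) :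
    ∃ F : Sym2 X → Fin r ⊕ (X ⊕ Fin 3),
      (∀ e, F e ∈ Finset.univ.disjSum (M.disjSum Finset.univ)) ∧
      (∀ x ∈ S, ∀ y ∈ S, F s(x, y) = Sum.inl (f s(x, y))) ∧
      (∀ s ∈ S, ∀ v ∈ P, F s(s, v) = Sum.inr (Sum.inr 0)) ∧
      (∀ s ∈ S, ∀ v ∉ S, v ∉ P → F s(s, v) = Sum.inr (Sum.inl (q v))) ∧
      (∀ v ∈ P, F s(β v, v) = Sum.inr (Sum.inr 1)) ∧
      (∀ v ∈ P, F s(γ v, v) = Sum.inr (Sum.inr 2)) ∧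
      (∀ u ∉ S, ∀ v ∉ S, u ∉ P → v ∉ P → q u = q v →
        F s(u, v) = Sum.inr (Sum.inr (κ (q u) s(u, v)))) := by
  classical
  let cr : X → Fin r ⊕ (X ⊕ Fin 3) := fun v =>
    if v ∈ P then Sum.inr (Sum.inr 0) else Sum.inr (Sum.inl (q v))
  let inner : X → X → Fin 3 := fun x y =>
    if x ∈ P ∧ y ∈ M then (if y = β x then 1 else 2)
    else if y ∈ P ∧ x ∈ M then (if x = β y then 1 else 2)
    else if q x = q y then κ (q x) s(x, y) else 0
  let g : X → X → Fin r ⊕ (X ⊕ Fin 3) := fun x y =>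
    if x ∈ S ∧ y ∈ S then Sum.inl (f s(x, y))
    else if x ∈ S then cr y else if y ∈ S then cr x else Sum.inr (Sum.inr (inner x y))
  have hinner : ∀ x y, inner x y = inner y x := by
    intro x y
    have := hM x
    have := hM y
    simp only [inner, Sym2.eq_swap (a := x) (b := y)]
    grind
  have hg : ∀ x y, g x y = g y x := by
    intro x y
    simp only [g, Sym2.eq_swap (a := x) (b := y), hinner x y]
    grind
  refine ⟨Sym2.lift ⟨g, hg⟩, ?_, ?_, ?_, ?_, ?_, ?_, ?_⟩
  · intro e
    induction e with | _ x y
    simp only [Sym2.lift_mk, g, cr]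
    split_ifs <;> simp <;> grind
  · intro x hx y hy
    simp [g, hx, hy]
  · intro s hs v hv
    simp [g, cr, hs, hv, (hP v hv).1]
  · intro s hs v hv hv'
    simp [g, cr, hs, hv, hv']
  · intro v hv
    obtain ⟨h1, h2, h3, h4⟩ := hP v hv
    simp [g, inner, h1, hMS _ h2, hv, h2, hM _ h2]
  · intro v hv
    obtain ⟨h1, h2, h3, h4⟩ := hP v hv
    simp [g, inner, h1, hMS _ h3, hv, h3, hM _ h3, h4.symm]
  · intro u hu v hv hu' hv' huv
    simp [g, inner, hu, hv, hu', hv', huv]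

/-- `u` can be joined to any rainbow connected subgraph through `s`, at the cost of the new
colors `D`. -/
def Attachable {X C₁ C₂ : Type*} (H : SimpleGraph X) (F : Sym2 X → C₁ ⊕ C₂) (u : X) (D : Set C₂)
    (s : X) : Prop :=
  ∀ (W : Set X) (D₀ : Set C₂), RainbowLinked H F W (Set.range Sum.inl ∪ Sum.inr '' D₀) → s ∈ W →
    Disjoint D₀ D → RainbowLinked H F (insert u W) (Set.range Sum.inl ∪ Sum.inr '' (D₀ ∪ D))

section Attachable

variable {X C₁ C₂ : Type*} {H : SimpleGraph X} {F : Sym2 X → C₁ ⊕ C₂}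

lemma Attachable.refl (s : X) : Attachable H F s ∅ s := by
  intro W D₀ h hs _
  exact h.mono (by simp [hs]) (by simp)

lemma Attachable.of_adj {s u : X} {x : C₂} (h : H.Adj s u) (hF : F s(s, u) = Sum.inr x) :
    Attachable H F u {x} s := by
  intro W D₀ hW hs hD
  have hx : x ∉ D₀ := by simpa using hD
  refine (hW.insert hs h (by simp [hF, hx])).mono subset_rfl ?_
  rw [hF, Set.image_union, Set.image_singleton, Set.union_singleton, Set.union_insert]

lemma Attachable.trans {s t u : X} {D E : Set C₂} (h₁ : Attachable H F t D s)
    (h₂ : Attachable H F u E t) (hDE : Disjoint D E) : Attachable H F u (D ∪ E) s := by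
  intro W D₀ hW hs hD
  rw [Set.disjoint_union_right] at hD
  have := h₂ _ _ (h₁ W D₀ hW hs hD.1) (by simp) (Set.disjoint_union_left.mpr ⟨hD.2, hDE⟩)
  refine this.mono (Set.insert_subset_insert (Set.subset_insert _ _)) ?_
  rw [Set.union_assoc]

lemma exists_rainbowLinked_of_attachable {S : Set X}
    (hbase : ∀ a ∈ S, ∀ b ∈ S, ∀ d ∈ S, RainbowLinked H F {a, b, d} (Set.range Sum.inl))
    {a b d s₁ s₂ s₃ : X} {D₁ D₂ D₃ : Set C₂} (h₁ : Attachable H F a D₁ s₁)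
    (h₂ : Attachable H F b D₂ s₂) (h₃ : Attachable H F d D₃ s₃) (hs₁ : s₁ ∈ S) (hs₂ : s₂ ∈ S)
    (hs₃ : s₃ ∈ S ∨ s₃ = b) (h12 : Disjoint D₁ D₂) (h13 : Disjoint D₁ D₃) (h23 : Disjoint D₂ D₃) :
    ∃ K, RainbowLinked H F {a, b, d} K := by
  obtain ⟨t, ht, hts⟩ : ∃ t ∈ S, s₃ ∈ ({b, t} : Set X) := by
    rcases hs₃ with h | h
    · exact ⟨s₃, h, by simp⟩
    · exact ⟨s₁, hs₁, by simp [h]⟩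
  have k0 : RainbowLinked H F {s₁, s₂, t} (Set.range Sum.inl ∪ Sum.inr '' ∅) := by
    simpa using hbase s₁ hs₁ s₂ hs₂ t ht
  have k1 := h₁ _ _ k0 (by simp) (by simp)
  have k2 := h₂ _ _ k1 (by simp) (by simpa using h12)
  have k3 := h₃ _ _ k2 (by
    simp only [Set.mem_insert_iff, Set.mem_singleton_iff] at hts ⊢; tauto) (by
    simpa using ⟨h13, h23⟩)
  refine ⟨_, k3.mono (fun x hx => ?_) subset_rfl⟩
  simp only [Set.mem_insert_iff, Set.mem_singleton_iff] at hx ⊢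
  tauto

end Attachable

lemma triple_rotate {X : Type*} (a b d : X) : ({a, b, d} : Set X) = {b, d, a} := by
  rw [Set.insert_comm, Set.pair_comm]

lemma triple_reverse {X : Type*} (a b d : X) : ({a, b, d} : Set X) = {d, b, a} := by
  rw [triple_rotate, Set.insert_comm]

lemma quadruple_reverse {X : Type*} (a b c d : X) : ({a, b, c, d} : Set X) = {d, c, b, a} := by
  ext; simp only [Set.mem_insert_iff, Set.mem_singleton_iff]; tauto

/-- If `S` is a dominating set of `H` whose triples are connected by rainbow subgraphs inside `S`
under an `r`-coloring, then some independent set `M` outside `S` has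
`rx₃(H) ≤ r + |M| + 3`. -/
lemma exists_independent_rxIndex_le {X : Type*} [Finite X] {r : ℕ} (hr : 0 < r)
    (H : SimpleGraph X) (S : Set X) (f : Sym2 X → Fin r)
    (hbase : ∀ a ∈ S, ∀ b ∈ S, ∀ d ∈ S, ∃ T : H.Subgraph, T.Connected ∧ T.verts ⊆ S ∧
      {a, b, d} ⊆ T.verts ∧ Set.InjOn f T.edgeSet)
    (hdom : ∀ v ∉ S, ∃ s ∈ S, H.Adj s v) :
    ∃ M : Finset X, (∀ x ∈ M, x ∉ S) ∧ (M : Set X).Pairwise (fun u v => ¬ H.Adj u v) ∧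
      rxIndex H 3 ≤ r + M.card + 3 := by
  classical
  have := Fintype.ofFinite X
  obtain ⟨M, P, q, β, γ, hMS, hind, hP, hq, hcl, hM⟩ := exists_maximum_independent_partition H Sᶜ
  refine ⟨M, hMS, hind, ?_⟩
  choose κ hκ using fun j : X =>
    exists_clique_coloring (Finset.univ.filter fun v => v ∉ S ∧ v ∉ P ∧ q v = j)
  simp only [Finset.mem_filter, Finset.mem_univ, true_and] at hκ
  obtain ⟨F, hFK, hFS, hFP, hFq, hFβ, hFγ, hFκ⟩ := exists_extended_coloring S P M q β γ κ f hMS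
    (fun v hv => ⟨(hP v hv).1, (hP v hv).2.1, (hP v hv).2.2.1, (hP v hv).2.2.2.1⟩) hq
    (fun x hx => (hM x hx).1)
  have hcard : (Finset.univ.disjSum (M.disjSum Finset.univ) :
      Finset (Fin r ⊕ (X ⊕ Fin 3))).card = r + M.card + 3 := by
    simp [Finset.card_disjSum, add_assoc]
  rw [← hcard]
  refine rxIndex_le_of_isRainbowColoring (isRainbowColoring_three_of_linked ?_) _
    (Finset.card_pos.mp (by omega)) fun e _ => hFK e
  have hbase' : ∀ a ∈ S, ∀ b ∈ S, ∀ d ∈ S, RainbowLinked H F {a, b, d} (Set.range Sum.inl) := by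
    intro a ha b hb d hd
    obtain ⟨T, h1, h2, h3, h4⟩ := hbase a ha b hb d hd
    have hT : ∀ e ∈ T.edgeSet, F e = Sum.inl (f e) := by
      intro e he
      induction e with | _ x y
      exact hFS x (h2 (T.edge_vert he)) y (h2 (T.edge_vert (T.symm.symm _ _ he)))
    refine ⟨T, h1, h3, fun e he e' he' hee => h4 he he' ?_, fun e he => ⟨f e, (hT e he).symm⟩⟩
    rwa [hT e he, hT e' he', Sum.inl.injEq] at hee
  -- the ways to attach a vertex outside `S`
  have attQ : ∀ v ∉ S, v ∉ P → ∃ s ∈ S, Attachable H F v {Sum.inl (q v)} s := by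
    intro v hv hvP
    obtain ⟨s, hs, hsv⟩ := hdom v hv
    exact ⟨s, hs, .of_adj hsv (hFq s hs v hv hvP)⟩
  have att0 : ∀ v ∈ P, ∃ s ∈ S, Attachable H F v {Sum.inr 0} s := by
    intro v hv
    obtain ⟨s, hs, hsv⟩ := hdom v (hP v hv).1
    exact ⟨s, hs, .of_adj hsv (hFP s hs v hv)⟩
  have attM : ∀ x ∈ M, ∃ s ∈ S, Attachable H F x {Sum.inl x} s := by
    intro x hx
    simpa only [(hM x hx).2] using attQ x (hMS x hx) (hM x hx).1
  have att1 : ∀ v ∈ P, ∃ s ∈ S, Attachable H F v {Sum.inl (β v), Sum.inr 1} s := by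
    intro v hv
    obtain ⟨-, h2, -, -, h5, -⟩ := hP v hv
    obtain ⟨s, hs, h⟩ := attM _ h2
    exact ⟨s, hs, h.trans (.of_adj h5.symm (hFβ v hv)) (by simp)⟩
  have att2 : ∀ v ∈ P, ∃ s ∈ S, Attachable H F v {Sum.inl (γ v), Sum.inr 2} s := by
    intro v hv
    obtain ⟨-, -, h3, -, -, h6⟩ := hP v hv
    obtain ⟨s, hs, h⟩ := attM _ h3
    exact ⟨s, hs, h.trans (.of_adj h6.symm (hFγ v hv)) (by simp)⟩
  -- vertices outside `P` need at most one color
  have attN : ∀ v ∉ P, ∃ D, (∃ s ∈ S, Attachable H F v D s) ∧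
      (v ∈ S ∧ D = ∅ ∨ v ∉ S ∧ D = {Sum.inl (q v)}) := by
    intro v hv
    by_cases hvS : v ∈ S
    · exact ⟨∅, ⟨v, hvS, .refl v⟩, Or.inl ⟨hvS, rfl⟩⟩
    · exact ⟨_, attQ v hvS hv, Or.inr ⟨hvS, rfl⟩⟩
  have linked : ∀ {a b d D₁ D₂ D₃}, (∃ s ∈ S, Attachable H F a D₁ s) →
      (∃ s ∈ S, Attachable H F b D₂ s) → (∃ s ∈ S, Attachable H F d D₃ s) →
      Disjoint D₁ D₂ → Disjoint D₁ D₃ → Disjoint D₂ D₃ →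
      ∃ K, RainbowLinked H F {a, b, d} K := by
    rintro a b d D₁ D₂ D₃ ⟨s₁, hs₁, h₁⟩ ⟨s₂, hs₂, h₂⟩ ⟨s₃, hs₃, h₃⟩ h12 h13 h23
    exact exists_rainbowLinked_of_attachable hbase' h₁ h₂ h₃ hs₁ hs₂ (.inl hs₃) h12 h13 h23
  have pair : ∀ a b d, b ≠ d → b ∉ S → d ∉ S → b ∉ P → d ∉ P → q b = q d →
      (a ∈ S ∨ a ∈ P ∨ q a ≠ q b) → ∃ K, RainbowLinked H F {a, b, d} K := by
    intro a b d hbd hb hd hbP hdP hqbd ha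
    have hadj := hcl b hb d hd hbP hdP hbd hqbd
    have hcol := hFκ b hb d hd hbP hdP hqbd
    obtain ⟨s, hs, hsb⟩ := attQ b hb hbP
    have hbd' : Attachable H F d {Sum.inr (κ (q b) s(b, d))} b := .of_adj hadj hcol
    obtain ⟨D, ⟨t, ht, hta⟩, hD1, hD2⟩ : ∃ D, (∃ s ∈ S, Attachable H F a D s) ∧
        Sum.inl (q b) ∉ D ∧ Sum.inr (κ (q b) s(b, d)) ∉ D := by
      by_cases haP : a ∈ P
      · by_cases hκ0 : κ (q b) s(b, d) = 0
        · by_cases hβ : q b = β a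
          · refine ⟨_, att2 a haP, ?_, ?_⟩
            · simpa [hβ] using (hP a haP).2.2.2.1
            · simp [hκ0]
          · exact ⟨_, att1 a haP, by simpa using hβ, by simp [hκ0]⟩
        · exact ⟨_, att0 a haP, by simp, by simpa using hκ0⟩
      · obtain ⟨D, hD, ⟨-, rfl⟩ | ⟨haS, rfl⟩⟩ := attN a haP
        · exact ⟨∅, hD, by simp, by simp⟩
        · refine ⟨_, hD, ?_, by simp⟩
          simpa [haS, haP, eq_comm] using ha
    exact exists_rainbowLinked_of_attachable hbase' hta hsb hbd' ht hs (.inr rfl)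
      (by simpa using hD1) (by simpa using hD2) (by simp)
  have twoP : ∀ a b d, a ∈ P → b ∈ P → d ∉ P → ∃ K, RainbowLinked H F {a, b, d} K := by
    intro a b d ha hb hd
    have hne := (hP b hb).2.2.2.1
    obtain ⟨D, hD, ⟨-, rfl⟩ | ⟨-, rfl⟩⟩ := attN d hd
    · exact linked (att0 a ha) (att1 b hb) hD (by simp) (by simp) (by simp)
    · by_cases h : β b = q d
      · exact linked (att0 a ha) (att2 b hb) hD (by simp) (by simp)
          (by simpa [eq_comm, h] using hne)
      · exact linked (att0 a ha) (att1 b hb) hD (by simp) (by simp) (by simpa [eq_comm] using h)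
  have threeP : ∀ a b d, a ∈ P → b ∈ P → d ∈ P → ∃ K, RainbowLinked H F {a, b, d} K := by
    intro a b d ha hb hd
    have hne := (hP a ha).2.2.2.1
    by_cases h1 : β b = γ d
    · by_cases h2 : β d = γ b
      · by_cases h3 : β a = γ d
        · have h4 : β b ≠ γ a := fun h => hne (h3.trans (h1.symm.trans h))
          rw [triple_reverse a b d]
          exact linked (att0 d hd) (att1 b hb) (att2 a ha) (by simp) (by simp)
            (by simpa [eq_comm] using h4)
        · rw [Set.insert_comm a b]
          exact linked (att0 b hb) (att1 a ha) (att2 d hd) (by simp) (by simp)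
            (by simpa [eq_comm] using h3)
      · rw [Set.pair_comm b d]
        exact linked (att0 a ha) (att1 d hd) (att2 b hb) (by simp) (by simp)
          (by simpa [eq_comm] using h2)
    · exact linked (att0 a ha) (att1 b hb) (att2 d hd) (by simp) (by simp)
        (by simpa [eq_comm] using h1)
  have oneP : ∀ a b d, a ∈ P → b ∉ P → d ∉ P → b ≠ d → ∃ K, RainbowLinked H F {a, b, d} K := by
    intro a b d ha hb hd hbd
    by_cases h : b ∉ S ∧ d ∉ S ∧ q b = q d
    · exact pair a b d hbd h.1 h.2.1 hb hd h.2.2 (.inr (.inl ha))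
    · obtain ⟨D, hD, ⟨hbS, rfl⟩ | ⟨hbS, rfl⟩⟩ := attN b hb <;>
        obtain ⟨E, hE, ⟨hdS, rfl⟩ | ⟨hdS, rfl⟩⟩ := attN d hd
      iterate 3 exact linked (att0 a ha) hD hE (by simp) (by simp) (by simp)
      exact linked (att0 a ha) hD hE (by simp) (by simp) (by
        simpa [hbS, hdS, eq_comm] using h)
  have noP : ∀ a b d, a ∉ P → b ∉ P → d ∉ P → a ≠ b → a ≠ d → b ≠ d →
      ∃ K, RainbowLinked H F {a, b, d} K := by
    intro a b d ha hb hd hab had hbd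
    by_cases hall : a ∉ S ∧ b ∉ S ∧ d ∉ S ∧ q a = q b ∧ q b = q d
    · obtain ⟨haS, hbS, hdS, h1, h2⟩ := hall
      obtain ⟨x, hx, y, hy, z, hz, w, hw, hxy, hyz, hne, h⟩ := hκ (q d) a ⟨haS, ha, h1.trans h2⟩
        b ⟨hbS, hb, h2⟩ d ⟨hdS, hd, rfl⟩ hab had hbd
      have hadj : ∀ u v, (u ∉ S ∧ u ∉ P ∧ q u = q d) → (v ∉ S ∧ v ∉ P ∧ q v = q d) → u ≠ v →
          H.Adj u v ∧ F s(u, v) = Sum.inr (Sum.inr (κ (q d) s(u, v))) := by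
        intro u v hu hv huv
        have huv' := hu.2.2.trans hv.2.2.symm
        refine ⟨hcl u hu.1 v hv.1 hu.2.1 hv.2.1 huv huv', ?_⟩
        rw [hFκ u hu.1 v hv.1 hu.2.1 hv.2.1 huv', hu.2.2]
      have a1 := hadj x y hx hy hxy
      have a2 := hadj y z hy hz hyz
      have l1 := (RainbowLinked.singleton (F := F) x).insert rfl a1.1 (by simp)
      have l2 := l1.insert (Set.mem_insert _ _) a2.1 (by simpa [a1.2, a2.2] using hne.symm)
      rcases h with h | ⟨h, hzw, n1, n2⟩
      · exact ⟨_, l2.mono (h.trans (triple_reverse x y z).subset) subset_rfl⟩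
      · have a3 := hadj z w hz hw hzw
        have l3 := l2.insert (Set.mem_insert _ _) a3.1 (by
          simpa [a1.2, a2.2, a3.2] using ⟨n2, n1⟩)
        exact ⟨_, l3.mono (h.trans (quadruple_reverse x y z w).subset) subset_rfl⟩
    by_cases h1 : b ∉ S ∧ d ∉ S ∧ q b = q d
    · exact pair a b d hbd h1.1 h1.2.1 hb hd h1.2.2 (by
        by_contra! hc
        exact hall ⟨hc.1, h1.1, h1.2.1, hc.2.2, h1.2.2⟩)
    by_cases h2 : a ∉ S ∧ d ∉ S ∧ q a = q d
    · rw [Set.insert_comm a b]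
      exact pair b a d had h2.1 h2.2.1 ha hd h2.2.2 (by
        by_contra! hc
        exact hall ⟨h2.1, hc.1, h2.2.1, hc.2.2.symm, hc.2.2.trans h2.2.2⟩)
    by_cases h3 : a ∉ S ∧ b ∉ S ∧ q a = q b
    · rw [← triple_rotate d a b]
      exact pair d a b hab h3.1 h3.2.1 ha hb h3.2.2 (by
        by_contra! hc
        exact hall ⟨h3.1, h3.2.1, hc.1, h3.2.2, (hc.2.2.trans h3.2.2).symm⟩)
    have disj : ∀ {u v D E}, (u ∈ S ∧ D = ∅ ∨ u ∉ S ∧ D = {Sum.inl (q u)}) →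
        (v ∈ S ∧ E = ∅ ∨ v ∉ S ∧ E = {Sum.inl (q v)}) → ¬ (u ∉ S ∧ v ∉ S ∧ q u = q v) →
        Disjoint D (E : Set (X ⊕ Fin 3)) := by
      rintro u v D E (⟨hu, rfl⟩ | ⟨hu, rfl⟩) (⟨hv, rfl⟩ | ⟨hv, rfl⟩) huv
      iterate 3 simp
      simpa [hu, hv, eq_comm] using huv
    obtain ⟨D₁, hD₁, c₁⟩ := attN a ha
    obtain ⟨D₂, hD₂, c₂⟩ := attN b hb
    obtain ⟨D₃, hD₃, c₃⟩ := attN d hd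
    exact linked hD₁ hD₂ hD₃ (disj c₁ c₂ h3) (disj c₁ c₃ h2) (disj c₂ c₃ h1)
  intro a b d hab had hbd
  by_cases ha : a ∈ P <;> by_cases hb : b ∈ P <;> by_cases hd : d ∈ P
  · exact threeP a b d ha hb hd
  · exact twoP a b d ha hb hd
  · rw [Set.pair_comm b d]; exact twoP a d b ha hd hb
  · exact oneP a b d ha hb hd hbd
  · rw [triple_rotate a b d]; exact twoP b d a hb hd ha
  · rw [Set.insert_comm a b]; exact oneP b a d hb ha hd had
  · rw [← triple_rotate d a b]; exact oneP d a b hd ha hb hab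
  · exact noP a b d ha hb hd hab had hbd

lemma exists_adj_dist_eq {V : Type*} {G : SimpleGraph V} (hG : G.Connected) {c v : V} {n : ℕ}
    (hv : G.dist c v = n + 1) : ∃ u, G.Adj u v ∧ G.dist c u = n := by
  obtain ⟨p, hp⟩ := hG.exists_walk_length_eq_dist v c
  rw [dist_comm, hv] at hp
  cases p with
  | nil => simp at hp
  | @cons _ u _ h p =>
    rw [Walk.length_cons, Nat.add_right_cancel_iff] at hp
    refine ⟨u, h.symm, ?_⟩
    have h₁ := dist_le p
    have h₂ := hG.dist_triangle (u := c) (v := u) (w := v)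
    rw [dist_eq_one_iff_adj.mpr h.symm] at h₂
    rw [dist_comm] at h₁
    omega

lemma connected_induce_ball {V : Type*} {G : SimpleGraph V} (hG : G.Connected) (c : V) (i : ℕ) :
    (G.induce {v | G.dist c v ≤ i}).Connected := by
  rw [connected_iff_exists_forall_reachable]
  refine ⟨⟨c, by simp⟩, ?_⟩
  suffices ∀ n, ∀ v (hv : G.dist c v ≤ i), G.dist c v = n →
      (G.induce {v | G.dist c v ≤ i}).Reachable ⟨c, by simp⟩ ⟨v, hv⟩ from
    fun v => this _ v.1 v.2 rfl
  intro n
  induction n with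
  | zero =>
    intro v hv h0
    obtain rfl := hG.dist_eq_zero_iff.mp h0
    rfl
  | succ n ih =>
    intro v hv hn
    obtain ⟨u, huv, hu⟩ := exists_adj_dist_eq hG hn
    refine (ih u (by omega) hu).trans (Adj.reachable ?_)
    exact huv

lemma subgraph_connected_map {X Y : Type*} {G : SimpleGraph X} {H : SimpleGraph Y} (φ : G →g H)
    {T : G.Subgraph} (hT : T.Connected) : (T.map φ).Connected := by
  rw [Subgraph.connected_iff'] at hT ⊢
  let ψ : T.coe →g (T.map φ).coe :=
    ⟨fun x => ⟨φ x, Set.mem_image_of_mem _ x.2⟩, fun {a b} h => ⟨a, b, h, rfl, rfl⟩⟩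
  refine hT.map ψ ?_
  rintro ⟨-, x, hx, rfl⟩
  exact ⟨⟨x, hx⟩, rfl⟩

lemma card_le_alphaSphere {V : Type*} [Finite V] {G : SimpleGraph V} {c : V} {i : ℕ} {M : Finset V}
    (hM : ∀ v ∈ M, G.dist c v = i) (hind : (M : Set V).Pairwise (fun u v => ¬ G.Adj u v)) :
    M.card ≤ alphaSphere G c i := by
  have := Fintype.ofFinite V
  refine le_csSup ⟨Fintype.card V, ?_⟩ ⟨M, hM, hind, rfl⟩
  rintro _ ⟨M', -, -, rfl⟩
  exact M'.card_le_univ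

end RainbowIndex

open RainbowIndex in
/-- Let `G` be a connected graph, `c` a vertex of `G`, and `i ≥ 1` an integer with
`i + 1 ≤ ecc(c)`. Let `S_i = N_G^i[c]` be the set of vertices at distance at most `i`
from `c`. Then `rx_3(G[S_i ∪ N_G^{i+1}(c)]) ≤ rx_3(G[S_i]) + α_{i+1}^0(G,c) + 3`. -/
theorem stmt_19 {V : Type} [Fintype V] (G : SimpleGraph V) (hG : G.Connected)
    (c : V) (i : ℕ) (hi : 1 ≤ i) (hecc : i + 1 ≤ ecc G c) :
    rxIndex (G.induce ({v | G.dist c v ≤ i} ∪ {v | G.dist c v = i + 1})) 3 ≤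
      rxIndex (G.induce {v | G.dist c v ≤ i}) 3 + alphaSphere G c (i + 1) + 3 := by
  classical
  have hG₀ := connected_induce_ball hG c i
  obtain ⟨f₀, hf₀⟩ := exists_isRainbowColoring_rxIndex hG₀ 3
  have c₀ : {v | G.dist c v ≤ i} := ⟨c, by simp⟩
  let X : Set V := {v | G.dist c v ≤ i} ∪ {v | G.dist c v = i + 1}
  let ι : G.induce {v | G.dist c v ≤ i} →g G.induce X :=
    (induceHomOfLE G Set.subset_union_left).toHom
  let ρ : X → {v | G.dist c v ≤ i} := fun x => if h : G.dist c x ≤ i then ⟨x, h⟩ else c₀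
  have hρι : ∀ x, ρ (ι x) = x := fun x => dif_pos (c := G.dist c x ≤ i) x.2
  obtain ⟨M, hMS, hind, hle⟩ := exists_independent_rxIndex_le (f₀ s(c₀, c₀)).pos (G.induce X)
    {x | G.dist c x ≤ i} (fun e => f₀ (e.map ρ)) (fun a ha b hb d hd => by
      obtain ⟨T, hT, hsub, hinj⟩ := exists_connected_of_isRainbowColoring hG₀ hf₀
        ⟨a, ha⟩ ⟨b, hb⟩ ⟨d, hd⟩
      have hmap : ∀ e : Sym2 _, (e.map ι).map ρ = e := by
        intro e
        rw [Sym2.map_map, show ρ ∘ ι = id from funext hρι, Sym2.map_id, id]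
      refine ⟨T.map ι, subgraph_connected_map ι hT, ?_, ?_, ?_⟩
      · rintro - ⟨x, -, rfl⟩
        exact x.2
      · rintro x (rfl | rfl | rfl)
        · exact ⟨⟨x, ha⟩, hsub (by simp), rfl⟩
        · exact ⟨⟨x, hb⟩, hsub (by simp), rfl⟩
        · exact ⟨⟨x, hd⟩, hsub (by simp), rfl⟩
      · rw [Subgraph.edgeSet_map]
        rintro - ⟨e, he, rfl⟩ - ⟨e', he', rfl⟩ h
        simp only [hmap] at h
        rw [hinj he he' h])
    (fun v hv => by
      obtain ⟨u, huv, hu⟩ := exists_adj_dist_eq hG (v.2.resolve_left hv)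
      exact ⟨⟨u, .inl hu.le⟩, hu.le, huv⟩)
  have hcard : (M.map (.subtype _)).card ≤ alphaSphere G c (i + 1) := by
    refine card_le_alphaSphere ?_ ?_
    · intro v hv
      obtain ⟨x, hx, rfl⟩ := Finset.mem_map.mp hv
      exact x.2.resolve_left (hMS x hx)
    · intro u hu v hv huv
      obtain ⟨x, hx, rfl⟩ := Finset.mem_map.mp hu
      obtain ⟨y, hy, rfl⟩ := Finset.mem_map.mp hv
      exact hind hx hy (fun h => huv (by rw [h]))
  rw [Finset.card_map] at hcard
  exact hle.trans (by omega)
end
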